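/- Let (l₁, …, l_p) and (l'₁, …, l'_p) be two families of p > 1 affine functions ℝⁿ → ℝ, where (l₁, …, l_p) is affinely independent, and suppose max(l₁, …, l_p) has minimal depth m. If max(l'₁, …, l'_p) has minimal depth m', then m' ≤ m; moreover, if (l'₁, …, l'_p) is also affinely independent, then m' = m. -/

import Mathlib

open Pointwise

noncomputable section

/-- `NN m n` is the set of functions `ℝⁿ → ℝ` representable by a ReLU neural network
with `m` hidden layers: `f = T⁽ᵐ⁺¹⁾ ∘ σ ∘ T⁽ᵐ⁾ ∘ σ ∘ ⋯ ∘ σ ∘ T⁽¹⁾` with each `T⁽ˡ⁾` affine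
and `σ` the componentwise ReLU.  (`NN 0 n` is the set of affine functions.) -/
def NN : ℕ → (n : ℕ) → Set ((Fin n → ℝ) → ℝ)
  | 0, n => {f | ∃ T : (Fin n → ℝ) →ᵃ[ℝ] ℝ, f = ⇑T}
  | m + 1, n => {f | ∃ (w : ℕ) (T : (Fin n → ℝ) →ᵃ[ℝ] (Fin w → ℝ)),
      ∃ g ∈ NN m w, f = fun x => g fun i => max (T x i) 0}

/-- Continuous piecewise linear functions `ℝⁿ → ℝ`: continuous functions that at each point
agree with one of finitely many affine functions. -/
def CPWL (n : ℕ) : Set ((Fin n → ℝ) → ℝ) :=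
  {f | Continuous f ∧ ∃ s : Finset ((Fin n → ℝ) →ᵃ[ℝ] ℝ), ∀ x, ∃ g ∈ s, f x = g x}

/-- `f` has minimal depth `m`: `f ∈ Υₙ(m)` and either `m = 0` or `f ∉ Υₙ(m-1)`. -/
def MinDepth (n : ℕ) (f : (Fin n → ℝ) → ℝ) (m : ℕ) : Prop :=
  f ∈ NN m n ∧ (m = 0 ∨ f ∉ NN (m - 1) n)

/-- `Mn n` is the least `m` such that `Υₙ = Υₙ(m)`. -/
def Mn (n : ℕ) : ℕ := sInf {m | CPWL n = NN m n}
/-- Precomposing a network with an affine map keeps its depth. -/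
theorem NN_comp_affine {m k n : ℕ} {f : (Fin k → ℝ) → ℝ} (hf : f ∈ NN m k)
    (S : (Fin n → ℝ) →ᵃ[ℝ] (Fin k → ℝ)) : (fun x => f (S x)) ∈ NN m n := by
  cases m with
  | zero =>
    obtain ⟨T, rfl⟩ := hf
    exact ⟨T.comp S, rfl⟩
  | succ m =>
    obtain ⟨w, T, g, hg, rfl⟩ := hf
    exact ⟨w, T.comp S, g, hg, rfl⟩

/-- Adding an affine function to a network keeps its depth. -/
theorem NN_add_affine {m n : ℕ} {f : (Fin n → ℝ) → ℝ} (hf : f ∈ NN m n)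
    (h : (Fin n → ℝ) →ᵃ[ℝ] ℝ) : (fun x => f x + h x) ∈ NN m n := by
  induction m generalizing n with
  | zero =>
    obtain ⟨T, rfl⟩ := hf
    exact ⟨T + h, rfl⟩
  | succ m ih =>
    obtain ⟨w, T, g, hg, rfl⟩ := hf
    let drop : (Fin (w + 2) → ℝ) →ᵃ[ℝ] (Fin w → ℝ) :=
      (LinearMap.funLeft ℝ ℝ fun i : Fin w => i.succ.succ).toAffineMap
    let coord (i : Fin (w + 2)) : (Fin (w + 2) → ℝ) →ᵃ[ℝ] ℝ :=
      (LinearMap.proj (R := ℝ) (φ := fun _ : Fin (w + 2) => ℝ) i).toAffineMap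
    refine ⟨w + 2, AffineMap.pi (Fin.cons h (Fin.cons (-h) fun i =>
        (LinearMap.proj (R := ℝ) (φ := fun _ : Fin w => ℝ) i).toAffineMap.comp T)),
      _, ih (NN_comp_affine hg drop) (coord 0 - coord 1), ?_⟩
    funext x
    have hpos : h x = max (h x) 0 - max (-h x) 0 := by
      rcases le_total (h x) 0 with hx | hx <;> simp [hx]
    exact congrArg (g (fun i => max (T x i) 0) + ·) hpos

/-- Every network can be realised with one more hidden layer. -/
theorem NN_subset_succ (m n : ℕ) : NN m n ⊆ NN (m + 1) n := by
  induction m generalizing n with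
  | zero =>
    rintro _ ⟨T, rfl⟩
    have hzero : (fun _ => 0 : (Fin n → ℝ) → ℝ) ∈ NN 1 n :=
      ⟨0, 0, fun _ => 0, ⟨0, rfl⟩, rfl⟩
    simpa using NN_add_affine hzero T
  | succ m ih =>
    rintro _ ⟨w, T, g, hg, rfl⟩
    exact ⟨w, T, g, ih w hg, rfl⟩

theorem NN_mono (n : ℕ) : Monotone fun m => NN m n :=
  monotone_nat_of_le_succ fun m => NN_subset_succ m n

theorem MinDepth.le_of_mem {n m k : ℕ} {f : (Fin n → ℝ) → ℝ} (hf : MinDepth n f m)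
    (hk : f ∈ NN k n) : m ≤ k := by
  by_contra! hlt
  rcases hf.2 with h | h
  · omega
  · exact h (NN_mono n (by omega : k ≤ m - 1) hk)

/-- A linearly independent family of covectors can be prescribed arbitrary affine values along
an affine map. -/
theorem exists_affineMap_dotProduct_eq {n : ℕ} {ι : Type*} [Fintype ι] {b : ι → Fin n → ℝ}
    (hb : LinearIndependent ℝ b) (d : (Fin n → ℝ) →ᵃ[ℝ] (ι → ℝ)) :
    ∃ S : (Fin n → ℝ) →ᵃ[ℝ] (Fin n → ℝ), ∀ x i, ∑ j, b i j * S x j = d x i := by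
  classical
  have hrange : LinearMap.range (Matrix.of b).mulVecLin = ⊤ := by
    apply Submodule.eq_top_of_finrank_eq
    rw [Module.finrank_fintype_fun_eq_card]
    exact LinearIndependent.rank_matrix (M := Matrix.of b) hb
  obtain ⟨R, hR⟩ := (Matrix.of b).mulVecLin.exists_rightInverse_of_surjective hrange
  refine ⟨R.toAffineMap.comp d, fun x i => ?_⟩
  exact congrFun (LinearMap.congr_fun hR (d x)) i

/-- The affine function `x ↦ ∑ j, v j * x j + c`. -/
def affineForm {n : ℕ} (v : Fin n → ℝ) (c : ℝ) : (Fin n → ℝ) →ᵃ[ℝ] ℝ :=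
  (∑ j, v j • LinearMap.proj (R := ℝ) (φ := fun _ : Fin n => ℝ) j).toAffineMap +
    AffineMap.const ℝ _ c

theorem affineForm_apply {n : ℕ} (v : Fin n → ℝ) (c : ℝ) (x : Fin n → ℝ) :
    affineForm v c x = (∑ j, v j * x j) + c := by
  simp [affineForm]

/-- Up to an affine substitution and an affine summand, the maximum of an affinely independent
family yields the maximum of every family of the same size. -/
theorem iSup_affine_mem_NN {n p m : ℕ} (hp : 0 < p) {a : Fin p → Fin n → ℝ} {c : Fin p → ℝ}
    (ha : AffineIndependent ℝ a)
    (hm : (fun x => ⨆ i, ((∑ j, a i j * x j) + c i)) ∈ NN m n)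
    (a' : Fin p → Fin n → ℝ) (c' : Fin p → ℝ) :
    (fun x => ⨆ i, ((∑ j, a' i j * x j) + c' i)) ∈ NN m n := by
  let i₀ : Fin p := ⟨0, hp⟩
  have : Nonempty (Fin p) := ⟨i₀⟩
  have hb := (affineIndependent_iff_linearIndependent_vsub ℝ a i₀).1 ha
  obtain ⟨S, hS⟩ := exists_affineMap_dotProduct_eq hb
    (AffineMap.pi fun i => affineForm (a' i) (c' i - c i) - affineForm (a' i₀) (c' i₀ - c i₀))
  have hdiff : ∀ x i, (∑ j, a' i j * x j) + c' i = ((∑ j, a i j * S x j) + c i) +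
      (affineForm (a' i₀) (c' i₀) - (affineForm (a i₀) (c i₀)).comp S) x := by
    intro x i
    by_cases hi : i = i₀
    · subst hi
      simp [affineForm_apply]
    · have := hS x ⟨i, hi⟩
      simp [affineForm_apply, sub_mul, Finset.sum_sub_distrib] at this ⊢
      linarith
  convert NN_add_affine (NN_comp_affine hm S)
    (affineForm (a' i₀) (c' i₀) - (affineForm (a i₀) (c i₀)).comp S) using 2 with x
  rw [ciSup_add (Set.finite_range _).bddAbove]
  exact iSup_congr (hdiff x)

/-- For two families of `p > 1` affine functions `lᵢ(x) = aᵢ·x + cᵢ` and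
`l'ᵢ(x) = a'ᵢ·x + c'ᵢ`, with `(a₁, …, a_p)` affinely independent: if `max(l₁, …, l_p)` has
minimal depth `m` and `max(l'₁, …, l'_p)` has minimal depth `m'`, then `m' ≤ m`, and if
`(a'₁, …, a'_p)` is also affinely independent then `m' = m`. -/
theorem statement10 (n p : ℕ) (hp : 1 < p)
    (a a' : Fin p → Fin n → ℝ) (c c' : Fin p → ℝ)
    (ha : AffineIndependent ℝ a) (m m' : ℕ)
    (hm : MinDepth n (fun x => ⨆ i, ((∑ j, a i j * x j) + c i)) m)
    (hm' : MinDepth n (fun x => ⨆ i, ((∑ j, a' i j * x j) + c' i)) m') :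
    m' ≤ m ∧ (AffineIndependent ℝ a' → m' = m) := by
  have key := iSup_affine_mem_NN (by omega) ha hm.1 a' c'
  refine ⟨hm'.le_of_mem key, fun ha' => le_antisymm (hm'.le_of_mem key) ?_⟩
  exact hm.le_of_mem (iSup_affine_mem_NN (by omega) ha' hm'.1 a c)
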